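/- For every x with 0 < x < x_G, the set 𝒰(x) is infinite; moreover, for every x ∈ [x_KL, x_G) the set 𝒰(x) is countably infinite. -/

import Mathlib

open scoped ENNReal NNReal Classical

namespace Expansions

/-- Digit sequences over the alphabet `{0,1,…,M}`; index `i : ℕ` represents the
`(i+1)`-st digit `d_{i+1}` of the paper. -/
abbrev Digits (M : ℕ) := ℕ → Fin (M + 1)

/-- `π_q((d_i)) = Σ_{i≥1} d_i / q^i`. -/
noncomputable def piQ (M : ℕ) (q : ℝ) (d : Digits M) : ℝ :=
  ∑' i : ℕ, (d i : ℝ) / q ^ (i + 1)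

/-- `𝒰_q` : the set of real numbers having a unique `q`-expansion. -/
def Uq (M : ℕ) (q : ℝ) : Set ℝ := {x | ∃! d : Digits M, piQ M q d = x}

/-- `𝐔_q` : the set of sequences that are the unique `q`-expansion of their value. -/
def UqSym (M : ℕ) (q : ℝ) : Set (Digits M) :=
  {d | ∀ e : Digits M, piQ M q e = piQ M q d → e = d}

/-- `𝒰(x)` : the set of univoque bases of `x`. -/
def Ubases (M : ℕ) (x : ℝ) : Set ℝ :=
  {q | q ∈ Set.Ioc (1 : ℝ) ((M : ℝ) + 1) ∧ x ∈ Uq M q}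

/-- `q_x = min{M+1, 1+M/x}`. -/
noncomputable def qx (M : ℕ) (x : ℝ) : ℝ := min ((M : ℝ) + 1) (1 + (M : ℝ) / x)

/-- Strict lexicographic order on digit sequences. -/
def lexLt {M : ℕ} (c d : Digits M) : Prop := ∃ n, (∀ i < n, c i = d i) ∧ c n < d n

def lexLe {M : ℕ} (c d : Digits M) : Prop := c = d ∨ lexLt c d

/-- The sequence ends with `0^∞`. -/
def EndsInZero {M : ℕ} (d : Digits M) : Prop := ∃ N, ∀ n ≥ N, d n = 0

/-- `d` is the quasi-greedy `q`-expansion of `x`: the lexicographically largest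
`q`-expansion of `x` not ending with `0^∞`. -/
def IsQuasiGreedy (M : ℕ) (q x : ℝ) (d : Digits M) : Prop :=
  piQ M q d = x ∧ ¬ EndsInZero d ∧
    ∀ e : Digits M, piQ M q e = x → ¬ EndsInZero e → lexLe e d

/-- `Φ_x(q)`: the quasi-greedy `q`-expansion of `x` (junk value if none exists). -/
noncomputable def Phi (M : ℕ) (x q : ℝ) : Digits M :=
  if h : ∃ d : Digits M, IsQuasiGreedy M q x d then h.choose else fun _ => 0

/-- `𝐔(x) = {Φ_x(q) : q ∈ 𝒰(x)}`. -/
def UxSym (M : ℕ) (x : ℝ) : Set (Digits M) := (Phi M x) '' (Ubases M x)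

/-- `ρ((c_i),(d_i)) = (M+1)^{-inf{i ≥ 1 : c_i ≠ d_i}}` (our index `n` represents the
`(n+1)`-st digit, whence the exponent `-(n+1)`); `ρ(c,c) = 0`. -/
noncomputable def rho (M : ℕ) (c d : Digits M) : ℝ :=
  if c = d then 0
  else ((M : ℝ) + 1) ^ (-(((sInf {i | c i ≠ d i} : ℕ) : ℤ) + 1))

/-- Diameter of a set with respect to a distance function, valued in `ℝ≥0∞`. -/
noncomputable def gdiam {X : Type*} (dist : X → X → ℝ) (A : Set X) : ℝ≥0∞ :=
  ⨆ x ∈ A, ⨆ y ∈ A, ENNReal.ofReal (dist x y)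

/-- The `s`-dimensional Hausdorff outer measure with respect to a distance function:
`lim_{δ→0⁺} inf {Σ diam(C n)^s : A ⊆ ⋃ C n, diam (C n) ≤ δ}`. -/
noncomputable def gHMeasure {X : Type*} (dist : X → X → ℝ) (s : ℝ) (A : Set X) : ℝ≥0∞ :=
  ⨆ (δ : ℝ) (_ : 0 < δ),
    ⨅ (C : ℕ → Set X) (_ : A ⊆ ⋃ n, C n)
      (_ : ∀ n, gdiam dist (C n) ≤ ENNReal.ofReal δ),
      ∑' n, gdiam dist (C n) ^ s

/-- Hausdorff dimension with respect to a distance function. -/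
noncomputable def gdimH {X : Type*} (dist : X → X → ℝ) (A : Set X) : ℝ≥0∞ :=
  ⨆ (s : ℝ≥0) (_ : gHMeasure dist (s : ℝ) A = ⊤), (s : ℝ≥0∞)

/-- The generalized golden ratio `q_G`. -/
noncomputable def qG (M : ℕ) : ℝ :=
  if M % 2 = 0 then ((M / 2 : ℕ) : ℝ) + 1
  else (((M / 2 : ℕ) : ℝ) + 1 +
    Real.sqrt (((M / 2 : ℕ) : ℝ) ^ 2 + 6 * ((M / 2 : ℕ) : ℝ) + 5)) / 2

/-- `x_G = M/(q_G - 1)`. -/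
noncomputable def xG (M : ℕ) : ℝ := (M : ℝ) / (qG M - 1)

/-- The Komornik–Loreti constant `q_KL = min 𝒰(1)`. -/
noncomputable def qKL (M : ℕ) : ℝ := sInf (Ubases M 1)

/-- `x_KL = M/(q_KL - 1)`. -/
noncomputable def xKL (M : ℕ) : ℝ := (M : ℝ) / (qKL M - 1)

/-- `X_iso`: the set of `x > 0` such that `𝒰(x)` contains an isolated point. -/
def Xiso (M : ℕ) : Set ℝ :=
  {x | 0 < x ∧ ∃ q ∈ Ubases M x, ∃ ε > 0, Ubases M x ∩ Set.Ioo (q - ε) (q + ε) = {q}}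

/-- The bifurcation set `𝒱 = {q ∈ (1,M+1] : 𝐔_r ≠ 𝐔_q for all r > q}`. -/
def Vset (M : ℕ) : Set ℝ :=
  {q | q ∈ Set.Ioc (1 : ℝ) ((M : ℝ) + 1) ∧
    ∀ r ∈ Set.Ioc (1 : ℝ) ((M : ℝ) + 1), q < r → UqSym M r ≠ UqSym M q}

/-- The Thue–Morse sequence `τ_i` = parity of the binary digit sum of `i`. -/
def tm (i : ℕ) : ℕ := (Nat.digits 2 i).sum % 2

/-- The shift `σⁿ`. -/
def shift {M : ℕ} (n : ℕ) (d : Digits M) : Digits M := fun i => d (i + n)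

/-- The reflection `d_i ↦ M - d_i`. -/
def reflect {M : ℕ} (d : Digits M) : Digits M := fun i => Fin.rev (d i)

@[simp] lemma shift_apply {M : ℕ} (n i : ℕ) (d : Digits M) : shift n d i = d (i + n) := rfl

@[simp] lemma shift_zero {M : ℕ} (d : Digits M) : shift 0 d = d := rfl

lemma shift_shift {M : ℕ} (m n : ℕ) (d : Digits M) : shift m (shift n d) = shift (m + n) d := by
  funext i
  simp [shift, Nat.add_assoc]

lemma reflect_shift {M : ℕ} (n : ℕ) (d : Digits M) : reflect (shift n d) = shift n (reflect d) :=
  rfl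

@[simp] lemma reflect_reflect {M : ℕ} (d : Digits M) : reflect (reflect d) = d := by
  funext i
  simp [reflect]

lemma reflect_apply_val {M : ℕ} (d : Digits M) (i : ℕ) :
    ((reflect d i : Fin (M + 1)) : ℕ) = M - d i := by
  simp [reflect, Fin.val_rev]

lemma digit_le {M : ℕ} (d : Digits M) (i : ℕ) : (d i : ℕ) ≤ M := Nat.lt_succ_iff.mp (d i).isLt

lemma reflect_apply_cast {M : ℕ} (d : Digits M) (i : ℕ) :
    (((reflect d i : Fin (M + 1)) : ℕ) : ℝ) = M - ((d i : ℕ) : ℝ) := by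
  rw [reflect_apply_val, Nat.cast_sub (digit_le d i)]

lemma hasSum_const_digit {q : ℝ} (hq : 1 < q) (a : ℝ) :
    HasSum (fun i : ℕ => a / q ^ (i + 1)) (a / (q - 1)) := by
  have h := (hasSum_geometric_of_lt_one (r := q⁻¹) (by positivity) (inv_lt_one_of_one_lt₀ hq)).mul_left
    (a * q⁻¹)
  have h1 : q - 1 ≠ 0 := by linarith
  have h2 : q ≠ 0 := by linarith
  have e1 : (fun i : ℕ => a / q ^ (i + 1)) = fun i => a * q⁻¹ * q⁻¹ ^ i := by
    funext i
    rw [pow_succ, inv_pow]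
    field_simp
  have e2 : a / (q - 1) = a * q⁻¹ * (1 - q⁻¹)⁻¹ := by
    field_simp
  rw [e1, e2]
  exact h

lemma summable_digits {M : ℕ} {q : ℝ} (hq : 1 < q) (d : Digits M) :
    Summable (fun i : ℕ => (d i : ℝ) / q ^ (i + 1)) := by
  have h0 : 0 < q := by linarith
  refine Summable.of_nonneg_of_le (fun i => by positivity) (fun i => ?_)
    (hasSum_const_digit hq (M : ℝ)).summable
  gcongr
  exact digit_le d i

lemma piQ_nonneg {M : ℕ} {q : ℝ} (hq : 1 < q) (d : Digits M) : 0 ≤ piQ M q d := by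
  have h0 : 0 < q := by linarith
  exact tsum_nonneg fun i => by positivity

lemma piQ_le {M : ℕ} {q : ℝ} (hq : 1 < q) (d : Digits M) : piQ M q d ≤ M / (q - 1) := by
  have h0 : 0 < q := by linarith
  rw [← (hasSum_const_digit hq (M : ℝ)).tsum_eq]
  refine (summable_digits hq d).tsum_le_tsum (fun i => ?_) (hasSum_const_digit hq (M : ℝ)).summable
  gcongr
  exact digit_le d i

lemma piQ_reflect {M : ℕ} {q : ℝ} (hq : 1 < q) (d : Digits M) :
    piQ M q (reflect d) = M / (q - 1) - piQ M q d := by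
  have h := (hasSum_const_digit hq (M : ℝ)).sub (summable_digits hq d).hasSum
  rw [piQ, piQ, ← h.tsum_eq]
  refine tsum_congr fun i => ?_
  rw [reflect_apply_cast]
  ring

lemma piQ_split {M : ℕ} {q : ℝ} (hq : 1 < q) (d : Digits M) (n : ℕ) :
    piQ M q d =
      ∑ i ∈ Finset.range n, (d i : ℝ) / q ^ (i + 1) + piQ M q (shift n d) / q ^ n := by
  rw [piQ, ← (summable_digits hq d).sum_add_tsum_nat_add n, piQ, ← tsum_div_const]
  congr 1
  refine tsum_congr fun i => ?_
  rw [shift_apply, div_div, ← pow_add]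
  congr 2
  ring

lemma piQ_step {M : ℕ} {q : ℝ} (hq : 1 < q) (d : Digits M) :
    q * piQ M q d = d 0 + piQ M q (shift 1 d) := by
  have h0 : q ≠ 0 := by linarith
  rw [piQ_split hq d 1]
  simp
  field_simp

lemma piQ_sub_of_agree {M : ℕ} {q : ℝ} (hq : 1 < q) {c d : Digits M} {n : ℕ}
    (h : ∀ i < n, c i = d i) :
    piQ M q d - piQ M q c = ((d n : ℝ) - (c n : ℝ) + piQ M q (shift (n + 1) d)
      - piQ M q (shift (n + 1) c)) / q ^ (n + 1) := by
  have hs : ∑ i ∈ Finset.range n, (c i : ℝ) / q ^ (i + 1) =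
      ∑ i ∈ Finset.range n, (d i : ℝ) / q ^ (i + 1) :=
    Finset.sum_congr rfl fun i hi => by rw [h i (Finset.mem_range.mp hi)]
  rw [piQ_split hq d (n + 1), piQ_split hq c (n + 1), Finset.sum_range_succ, Finset.sum_range_succ,
    hs]
  ring

lemma le_piQ {M : ℕ} {q : ℝ} (hq : 1 < q) (d : Digits M) (i : ℕ) :
    (d i : ℝ) / q ^ (i + 1) ≤ piQ M q d := by
  have h0 : 0 < q := by linarith
  exact (summable_digits hq d).le_tsum i fun j _ => by positivity

lemma piQ_pos_of_digit {M : ℕ} {q : ℝ} (hq : 1 < q) (d : Digits M) {i : ℕ} (hi : (0 : ℕ) < d i) :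
    0 < piQ M q d := by
  have h0 : 0 < q := by linarith
  have : (0 : ℝ) < (d i : ℕ) := by exact_mod_cast hi
  exact lt_of_lt_of_le (by positivity) (le_piQ hq d i)

lemma sum_digits_anti {M : ℕ} {p q : ℝ} (hp : 1 < p) (hpq : p ≤ q) (d : Digits M) (n : ℕ) :
    ∑ i ∈ Finset.range n, (d i : ℝ) / q ^ (i + 1) ≤
      ∑ i ∈ Finset.range n, (d i : ℝ) / p ^ (i + 1) := by
  have h0 : 0 < p := by linarith
  gcongr

lemma piQ_sub_ge {M : ℕ} {p q : ℝ} (hp : 1 < p) (hpq : p ≤ q) (d : Digits M) (i : ℕ) :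
    (d i : ℝ) / p ^ (i + 1) - (d i : ℝ) / q ^ (i + 1) ≤ piQ M p d - piQ M q d := by
  have h0 : 0 < p := by linarith
  have hs := (summable_digits hp d).sub (summable_digits (hp.trans_le hpq) d)
  rw [piQ, piQ, ← (summable_digits hp d).tsum_sub (summable_digits (hp.trans_le hpq) d)]
  refine hs.le_tsum i fun j _ => ?_
  rw [sub_nonneg]
  gcongr

lemma piQ_strict_anti {M : ℕ} {p q : ℝ} (hp : 1 < p) (hpq : p < q) (d : Digits M) {i : ℕ}
    (hi : (0 : ℕ) < d i) : piQ M q d < piQ M p d := by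
  have h0 : 0 < p := by linarith
  have hd : (0 : ℝ) < (d i : ℕ) := by exact_mod_cast hi
  have h := piQ_sub_ge hp hpq.le d i
  have : (d i : ℝ) / q ^ (i + 1) < (d i : ℝ) / p ^ (i + 1) := by
    gcongr
  linarith

lemma continuousOn_piQ_base {M : ℕ} {p : ℝ} (hp : 1 < p) (d : Digits M) :
    ContinuousOn (fun q => piQ M q d) (Set.Ici p) := by
  have h0 : 0 < p := by linarith
  refine continuousOn_tsum (u := fun i : ℕ => (M : ℝ) / p ^ (i + 1)) (fun i => ?_)
    (hasSum_const_digit hp (M : ℝ)).summable fun i q hq => ?_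
  · refine continuousOn_const.div (by fun_prop) fun q hq => ?_
    have : 0 < q := h0.trans_le hq
    positivity
  · have hq' : p ≤ q := hq
    have : 0 < q := h0.trans_le hq
    rw [Real.norm_of_nonneg (by positivity)]
    gcongr
    exact digit_le d i

lemma continuous_piQ {M : ℕ} {q : ℝ} (hq : 1 < q) : Continuous (piQ M q) := by
  have h0 : 0 < q := by linarith
  refine continuous_tsum (u := fun i : ℕ => (M : ℝ) / q ^ (i + 1)) (fun i => ?_)
    (hasSum_const_digit hq (M : ℝ)).summable fun i d => ?_
  · have : Continuous fun a : Fin (M + 1) => ((a : ℕ) : ℝ) / q ^ (i + 1) :=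
      continuous_of_discreteTopology
    exact this.comp (continuous_apply i)
  · rw [Real.norm_of_nonneg (by positivity)]
    gcongr
    exact digit_le d i

lemma exists_base {M : ℕ} {p q x : ℝ} (hp : 1 < p) (hpq : p ≤ q) (d : Digits M)
    (h1 : piQ M q d ≤ x) (h2 : x ≤ piQ M p d) : ∃ r ∈ Set.Icc p q, piQ M r d = x :=
  intermediate_value_Icc' hpq ((continuousOn_piQ_base hp d).mono fun _ h => h.1) ⟨h1, h2⟩

lemma exists_first_diff {M : ℕ} {c d : Digits M} (h : c ≠ d) :
    ∃ n, (∀ i < n, c i = d i) ∧ c n ≠ d n := by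
  have h' : ∃ n, c n ≠ d n := Function.ne_iff.mp h
  exact ⟨Nat.find h', fun i hi => not_not.mp (Nat.find_min h' hi), Nat.find_spec h'⟩

lemma lexLt_trichotomy {M : ℕ} (c d : Digits M) : c = d ∨ lexLt c d ∨ lexLt d c := by
  by_cases h : c = d
  · exact Or.inl h
  · obtain ⟨n, hn, hne⟩ := exists_first_diff h
    rcases lt_or_gt_of_ne hne with h | h
    · exact Or.inr (Or.inl ⟨n, hn, h⟩)
    · exact Or.inr (Or.inr ⟨n, fun i hi => (hn i hi).symm, h⟩)

/-- A base large enough that `π_q` is strictly monotone for the lexicographic order. -/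
noncomputable def lexValue {M : ℕ} (d : Digits M) : ℝ := piQ M (M + 2) d

lemma one_lt_lexBase (M : ℕ) : (1 : ℝ) < (M : ℝ) + 2 := by
  have : (0 : ℝ) ≤ M := Nat.cast_nonneg M
  linarith

lemma lexValue_lt {M : ℕ} {c d : Digits M} (h : lexLt c d) : lexValue c < lexValue d := by
  obtain ⟨n, hn, hlt⟩ := h
  have hM : (0 : ℝ) ≤ M := Nat.cast_nonneg M
  have hq := one_lt_lexBase M
  have h1 := piQ_sub_of_agree hq hn
  have h2 := piQ_nonneg hq (shift (n + 1) d)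
  have h3 := piQ_le hq (shift (n + 1) c)
  have h4 : (M : ℝ) / ((M : ℝ) + 2 - 1) < 1 := by
    rw [div_lt_one (by linarith)]
    linarith
  have h5 : ((c n : ℕ) : ℝ) + 1 ≤ (d n : ℕ) := by exact_mod_cast hlt
  have : 0 < piQ M (M + 2) d - piQ M (M + 2) c := by
    rw [h1]
    apply div_pos _ (by positivity)
    linarith
  simpa [lexValue] using this

lemma lexLt_iff {M : ℕ} {c d : Digits M} : lexLt c d ↔ lexValue c < lexValue d := by
  refine ⟨lexValue_lt, fun h => ?_⟩
  rcases lexLt_trichotomy c d with h' | h' | h'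
  · exact absurd h (by simp [h'])
  · exact h'
  · exact absurd h (lexValue_lt h').le.not_gt

lemma lexLe_iff {M : ℕ} {c d : Digits M} : lexLe c d ↔ lexValue c ≤ lexValue d := by
  constructor
  · rintro (rfl | h)
    · exact le_rfl
    · exact (lexValue_lt h).le
  · intro h
    rcases lexLt_trichotomy c d with h' | h' | h'
    · exact Or.inl h'
    · exact Or.inr h'
    · exact absurd h (lexValue_lt h').not_ge

lemma lexValue_injective {M : ℕ} : Function.Injective (lexValue (M := M)) := by
  intro c d h
  rcases lexLt_trichotomy c d with h' | h' | h'
  · exact h'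
  · exact absurd h (lexValue_lt h').ne
  · exact absurd h (lexValue_lt h').ne'

lemma continuous_lexValue {M : ℕ} : Continuous (lexValue (M := M)) :=
  continuous_piQ (one_lt_lexBase M)

lemma lexValue_reflect {M : ℕ} (d : Digits M) :
    lexValue (reflect d) = M / ((M : ℝ) + 2 - 1) - lexValue d :=
  piQ_reflect (one_lt_lexBase M) d

lemma continuous_shift {M : ℕ} (n : ℕ) : Continuous (shift (M := M) n) :=
  continuous_pi fun i => continuous_apply (i + n)

lemma continuous_reflect {M : ℕ} : Continuous (reflect (M := M)) :=
  continuous_pi fun i => (continuous_of_discreteTopology (f := Fin.rev)).comp (continuous_apply i)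

lemma mem_UqSym {M : ℕ} {q : ℝ} (hq : 1 < q) {c : Digits M}
    (h1 : ∀ i, (c i : ℕ) < M → piQ M q (shift (i + 1) c) < 1)
    (h2 : ∀ i, 0 < (c i : ℕ) → piQ M q (reflect (shift (i + 1) c)) < 1) : c ∈ UqSym M q := by
  intro e he
  by_contra hne
  have h0 : 0 < q := by linarith
  obtain ⟨n, hn, hd⟩ := exists_first_diff hne
  have h := piQ_sub_of_agree hq hn
  rw [he, sub_self, eq_comm, div_eq_zero_iff, or_iff_left (by positivity)] at h
  have hd' : (e n : ℕ) ≠ c n := fun h => hd (Fin.ext h)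
  rcases lt_or_gt_of_ne hd' with hlt | hlt
  · have h3 := h2 n (by omega)
    rw [piQ_reflect hq] at h3
    have h4 := piQ_le hq (shift (n + 1) e)
    have h5 : ((e n : ℕ) : ℝ) + 1 ≤ (c n : ℕ) := by exact_mod_cast hlt
    linarith
  · have h3 := h1 n (by have := digit_le e n; omega)
    have h4 := piQ_nonneg hq (shift (n + 1) e)
    have h5 : ((c n : ℕ) : ℝ) + 1 ≤ (e n : ℕ) := by exact_mod_cast hlt
    linarith

lemma exists_digit {M : ℕ} {q : ℝ} (hq : 1 < q) (hqM : q ≤ M + 1) {y : ℝ}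
    (hy : y ∈ Set.Ioc 0 ((M : ℝ) / (q - 1))) :
    ∃ a : Fin (M + 1), q * y - (a : ℕ) ∈ Set.Ioc 0 ((M : ℝ) / (q - 1)) := by
  obtain ⟨hy0, hy1⟩ := hy
  have hq1 : 0 < q - 1 := by linarith
  have h1 : 1 ≤ (M : ℝ) / (q - 1) := by
    rw [le_div_iff₀ hq1]
    linarith
  have hqy : 0 < q * y := by positivity
  have hc : 0 < ⌈q * y⌉₊ := Nat.ceil_pos.mpr hqy
  have hc1 := Nat.le_ceil (q * y)
  have hc2 := Nat.ceil_lt_add_one hqy.le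
  by_cases h : ⌈q * y⌉₊ ≤ M + 1
  · refine ⟨⟨⌈q * y⌉₊ - 1, by omega⟩, ?_⟩
    simp only [Nat.cast_sub hc, Nat.cast_one]
    exact ⟨by linarith, by linarith⟩
  · have h2 : (M : ℝ) + 1 < q * y := by
      have := Nat.lt_ceil.mp (not_le.mp h)
      exact_mod_cast this
    refine ⟨⟨M, by omega⟩, by simp only; linarith, ?_⟩
    have h3 : q * y ≤ q * (M / (q - 1)) := by gcongr
    have h4 : q * ((M : ℝ) / (q - 1)) - M = M / (q - 1) := by
      field_simp
      ring
    simp only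
    linarith

lemma exists_expansion_pos {M : ℕ} {q : ℝ} (hq : 1 < q) (hqM : q ≤ M + 1) {y : ℝ}
    (hy : y ∈ Set.Ioc 0 ((M : ℝ) / (q - 1))) :
    ∃ d : Digits M, piQ M q d = y ∧ ∀ n, 0 < piQ M q (shift n d) := by
  have h0 : 0 < q := by linarith
  choose! f hf using fun (y : ℝ) (hy : y ∈ Set.Ioc 0 ((M : ℝ) / (q - 1))) =>
    exists_digit hq hqM hy
  let r : ℕ → ℝ := fun n => (fun z => q * z - (f z : ℕ))^[n] y
  have hr0 : r 0 = y := rfl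
  have hr : ∀ n, r (n + 1) = q * r n - (f (r n) : ℕ) := fun n =>
    Function.iterate_succ_apply' _ n y
  have hmem : ∀ n, r n ∈ Set.Ioc 0 ((M : ℝ) / (q - 1)) := by
    intro n
    induction n with
    | zero => exact hy
    | succ n ih => rw [hr]; exact hf _ ih
  have hsum : ∀ n k, r n = ∑ i ∈ Finset.range k, (f (r (i + n)) : ℝ) / q ^ (i + 1)
      + r (k + n) / q ^ k := by
    intro n k
    induction k with
    | zero => simp
    | succ k ih =>
      rw [Finset.sum_range_succ, add_right_comm k 1 n, hr, ih]
      field_simp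
      ring
  have key : ∀ n, piQ M q (fun i => f (r (i + n))) = r n := by
    intro n
    have ht := (summable_digits hq (fun i => f (r (i + n)))).hasSum.tendsto_sum_nat
    have hz : Filter.Tendsto (fun k => r (k + n) / q ^ k) Filter.atTop (nhds 0) := by
      have hg : Filter.Tendsto (fun k : ℕ => (M : ℝ) / (q - 1) / q ^ k) Filter.atTop (nhds 0) :=
        tendsto_const_nhds.div_atTop (tendsto_pow_atTop_atTop_of_one_lt hq)
      refine squeeze_zero (fun k => ?_) (fun k => ?_) hg
      · have := (hmem (k + n)).1
        positivity
      · have := (hmem (k + n)).2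
        gcongr
    have hc := ht.add hz
    rw [add_zero] at hc
    refine tendsto_nhds_unique hc ?_
    refine tendsto_const_nhds.congr fun k => hsum n k
  refine ⟨fun i => f (r i), key 0, fun n => ?_⟩
  rw [show shift n (fun i => f (r i)) = fun i => f (r (i + n)) from rfl, key n]
  exact (hmem n).1

lemma exists_expansion {M : ℕ} {q : ℝ} (hq : 1 < q) (hqM : q ≤ M + 1) {y : ℝ}
    (hy : y ∈ Set.Icc 0 ((M : ℝ) / (q - 1))) : ∃ d : Digits M, piQ M q d = y := by
  rcases hy.1.eq_or_lt with h | h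
  · exact ⟨fun _ => 0, by simp [piQ, ← h]⟩
  · obtain ⟨d, hd, -⟩ := exists_expansion_pos hq hqM ⟨h, hy.2⟩
    exact ⟨d, hd⟩

lemma piQ_shift_lt_one_of_mem_UqSym {M : ℕ} {q : ℝ} (hq : 1 < q) (hqM : q ≤ M + 1) {c : Digits M}
    (hc : c ∈ UqSym M q) {i : ℕ} (hi : (c i : ℕ) < M) : piQ M q (shift (i + 1) c) < 1 := by
  by_contra! h
  obtain ⟨e, he⟩ := exists_expansion (M := M) hq hqM
    (y := piQ M q (shift (i + 1) c) - 1) ⟨by linarith, by linarith [piQ_le hq (shift (i + 1) c)]⟩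
  let g : Digits M := fun j =>
    if j < i then c j else if j = i then ⟨c i + 1, by omega⟩ else e (j - (i + 1))
  have hagree : ∀ j < i, c j = g j := fun j hj => by simp [g, hj]
  have hg : shift (i + 1) g = e := by
    funext j
    have h1 : ¬ j + (i + 1) < i := by omega
    have h2 : ¬ j + (i + 1) = i := by omega
    simp [g, shift, h1, h2]
  have hgi : (g i : ℕ) = c i + 1 := by simp [g]
  have h1 := piQ_sub_of_agree hq hagree
  rw [hg, he, hgi] at h1
  have h2 : piQ M q g = piQ M q c := by
    rw [← sub_eq_zero, h1]
    push_cast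
    ring
  have := congrArg (fun d : Digits M => (d i : ℕ)) (hc g h2)
  simp only [hgi] at this
  omega

lemma reflect_mem_UqSym {M : ℕ} {q : ℝ} (hq : 1 < q) {c : Digits M}
    (hc : c ∈ UqSym M q) : reflect c ∈ UqSym M q := by
  intro e he
  have : reflect e = c := hc _ (by rw [piQ_reflect hq, he, piQ_reflect hq]; ring)
  rw [← this, reflect_reflect]

/-- The sequence `d_1 … d_n t_1 t_2 …`. -/
def concat {M : ℕ} (d : Digits M) (n : ℕ) (t : Digits M) : Digits M :=
  fun i => if i < n then d i else t (i - n)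

lemma concat_of_lt {M : ℕ} (d : Digits M) {n i : ℕ} (t : Digits M) (h : i < n) :
    concat d n t i = d i := if_pos h

lemma concat_of_le {M : ℕ} (d : Digits M) {n i : ℕ} (t : Digits M) (h : n ≤ i) :
    concat d n t i = t (i - n) := if_neg h.not_gt

lemma shift_concat_of_le {M : ℕ} (d : Digits M) {n j : ℕ} (t : Digits M) (h : n ≤ j) :
    shift j (concat d n t) = shift (j - n) t := by
  funext i
  rw [shift_apply, concat_of_le _ _ (by omega), shift_apply]
  congr 1
  omega

lemma sum_concat {M : ℕ} (d : Digits M) {n j : ℕ} (t : Digits M) (h : j ≤ n) (q : ℝ) :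
    ∑ i ∈ Finset.range j, (concat d n t i : ℝ) / q ^ (i + 1) =
      ∑ i ∈ Finset.range j, (d i : ℝ) / q ^ (i + 1) :=
  Finset.sum_congr rfl fun i hi => by
    rw [concat_of_lt _ _ ((Finset.mem_range.mp hi).trans_le h)]

lemma piQ_zeros_concat {M : ℕ} {q : ℝ} (hq : 1 < q) (n : ℕ) (t : Digits M) :
    piQ M q (concat (fun _ => 0) n t) = piQ M q t / q ^ n := by
  rw [piQ_split hq _ n, sum_concat _ _ le_rfl, shift_concat_of_le _ _ le_rfl]
  simp

lemma exists_digit_pos {M : ℕ} {q : ℝ} {d : Digits M} (h : 0 < piQ M q d) :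
    ∃ i, (0 : ℕ) < d i := by
  by_contra! h'
  have : piQ M q d = 0 := by
    rw [piQ]
    convert tsum_zero with i
    simp [Nat.le_zero.mp (h' i)]
  linarith

/-- The balanced sequence alternating between `⌊M/2⌋` and `⌈M/2⌉`. -/
def balanced (M : ℕ) : Digits M := fun i =>
  if i % 2 = 0 then ⟨M / 2, by omega⟩ else ⟨M - M / 2, by omega⟩

lemma balanced_zero (M : ℕ) : ((balanced M 0 : Fin (M + 1)) : ℕ) = M / 2 := rfl

lemma balanced_one (M : ℕ) : ((balanced M 1 : Fin (M + 1)) : ℕ) = M - M / 2 := rfl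

lemma shift_one_balanced (M : ℕ) : shift 1 (balanced M) = reflect (balanced M) := by
  funext i
  apply Fin.ext
  rw [reflect_apply_val, shift_apply]
  rcases Nat.mod_two_eq_zero_or_one i with h | h
  · have h' : (i + 1) % 2 = 1 := by omega
    simp [balanced, h, h']
  · have h' : (i + 1) % 2 = 0 := by omega
    simp only [balanced, h, h', if_true, one_ne_zero, if_false]
    omega

lemma shift_balanced (M n : ℕ) :
    shift n (balanced M) = balanced M ∨ shift n (balanced M) = reflect (balanced M) := by
  induction n with
  | zero => exact Or.inl rfl
  | succ n ih =>
    rw [Nat.add_comm, ← shift_shift]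
    rcases ih with h | h
    · rw [h, shift_one_balanced]
      exact Or.inr rfl
    · rw [h, ← reflect_shift, shift_one_balanced, reflect_reflect]
      exact Or.inl rfl

lemma qG_bounds {M : ℕ} (hM : 0 < M) : 1 < qG M ∧ qG M < M + 1 := by
  rcases Nat.even_or_odd' M with ⟨k, rfl | rfl⟩
  · have h1 : (2 * k) % 2 = 0 := by omega
    have h2 : 2 * k / 2 = k := by omega
    have hk : (1 : ℝ) ≤ k := by exact_mod_cast (by omega : 1 ≤ k)
    rw [qG, if_pos h1, h2]
    push_cast
    constructor <;> linarith
  · have h1 : ¬ (2 * k + 1) % 2 = 0 := by omega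
    have h2 : (2 * k + 1) / 2 = k := by omega
    have hk : (0 : ℝ) ≤ k := Nat.cast_nonneg k
    rw [qG, if_neg h1, h2]
    have h3 : (k : ℝ) + 1 < √((k : ℝ) ^ 2 + 6 * k + 5) := by
      apply Real.lt_sqrt_of_sq_lt
      nlinarith
    have h4 : √((k : ℝ) ^ 2 + 6 * k + 5) < 3 * k + 3 := by
      rw [Real.sqrt_lt' (by linarith)]
      nlinarith
    push_cast
    constructor <;> linarith

lemma sq_gt_of_qG_lt {M : ℕ} (hM : 0 < M) {q : ℝ} (hq : qG M < q) :
    ((M - M / 2 : ℕ) : ℝ) * q + (M / 2 : ℕ) + 1 < q ^ 2 := by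
  rcases Nat.even_or_odd' M with ⟨k, rfl | rfl⟩
  · have h1 : (2 * k) % 2 = 0 := by omega
    have h2 : 2 * k / 2 = k := by omega
    have h3 : 2 * k - k = k := by omega
    have hk : (0 : ℝ) ≤ k := Nat.cast_nonneg k
    rw [qG, if_pos h1, h2] at hq
    rw [h2, h3]
    nlinarith
  · have h1 : ¬ (2 * k + 1) % 2 = 0 := by omega
    have h2 : (2 * k + 1) / 2 = k := by omega
    have h3 : 2 * k + 1 - k = k + 1 := by omega
    have hk : (0 : ℝ) ≤ k := Nat.cast_nonneg k
    rw [qG, if_neg h1, h2] at hq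
    rw [h2, h3]
    have h4 := Real.sqrt_nonneg ((k : ℝ) ^ 2 + 6 * k + 5)
    have h5 := Real.sq_sqrt (by positivity : (0 : ℝ) ≤ (k : ℝ) ^ 2 + 6 * k + 5)
    push_cast
    nlinarith

lemma piQ_balanced_lt {M : ℕ} (hM : 0 < M) {q : ℝ} (hq : qG M < q) :
    piQ M q (balanced M) < 1 ∧ piQ M q (reflect (balanced M)) < 1 := by
  have h1 : 1 < q := (qG_bounds hM).1.trans hq
  have h2 := sq_gt_of_qG_lt hM hq
  have h3 := piQ_step h1 (balanced M)
  have h4 := piQ_step h1 (reflect (balanced M))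
  rw [shift_one_balanced, balanced_zero] at h3
  rw [← reflect_shift, shift_one_balanced, reflect_reflect, reflect_apply_val, balanced_zero] at h4
  have h5 : ((M / 2 : ℕ) : ℝ) ≤ ((M - M / 2 : ℕ) : ℝ) := by
    exact_mod_cast (by omega : M / 2 ≤ M - M / 2)
  generalize piQ M q (balanced M) = y at *
  generalize piQ M q (reflect (balanced M)) = z at *
  generalize ((M / 2 : ℕ) : ℝ) = b at *
  generalize ((M - M / 2 : ℕ) : ℝ) = a at *
  have hz : z * (q ^ 2 - 1) = a * q + b := by linear_combination q * h4 + h3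
  have hy : y * (q ^ 2 - 1) = b * q + a := by linear_combination q * h3 + h4
  have hpos : 0 < q ^ 2 - 1 := by nlinarith
  constructor
  · rw [← mul_lt_mul_iff_left₀ hpos, hy]
    nlinarith
  · rw [← mul_lt_mul_iff_left₀ hpos, hz]
    linarith

lemma piQ_shift_balanced_lt {M : ℕ} (hM : 0 < M) {q : ℝ} (hq : qG M < q) (n : ℕ) :
    piQ M q (shift n (balanced M)) < 1 ∧ piQ M q (reflect (shift n (balanced M))) < 1 := by
  obtain ⟨h1, h2⟩ := piQ_balanced_lt hM hq
  rcases shift_balanced M n with h | h <;> rw [h]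
  · exact ⟨h1, h2⟩
  · rw [reflect_reflect]
    exact ⟨h2, h1⟩

lemma infinite_Ubases_of_family {M : ℕ} {x : ℝ} {S : Set ℕ} (hS : S.Infinite) (c : ℕ → Digits M)
    (hc : ∀ n ∈ S, ∀ m ∈ S, n < m → c n ≠ c m)
    (h : ∀ n ∈ S, ∃ q ∈ Set.Ioc (1 : ℝ) (M + 1), piQ M q (c n) = x ∧ c n ∈ UqSym M q) :
    (Ubases M x).Infinite := by
  choose! f hf hx hu using h
  refine Set.infinite_of_injOn_mapsTo (f := f) (s := S) ?_ ?_ hS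
  · intro n hn m hm hnm
    have he : c n = c m := hu m hm _ (by rw [← hnm, hx n hn, hnm, hx m hm])
    rcases lt_trichotomy n m with h | h | h
    · exact absurd he (hc n hn m hm h)
    · exact h
    · exact absurd he.symm (hc m hm n hn h)
  · intro n hn
    exact ⟨hf n hn, c n, hx n hn, fun e he => hu n hn e (he.trans (hx n hn).symm)⟩

lemma infinite_Ubases_of_one_le {M : ℕ} (hM : 0 < M) {x : ℝ} (hx1 : 1 ≤ x) (hx : x < xG M) :
    (Ubases M x).Infinite := by
  obtain ⟨hG1, hG2⟩ := qG_bounds hM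
  have hM' : (0 : ℝ) < M := by exact_mod_cast hM
  have hx0 : 0 < x := by linarith
  set Q : ℝ := 1 + M / x with hQ
  have hGQ : qG M < Q := by
    rw [xG, lt_div_iff₀ (by linarith)] at hx
    have : qG M - 1 < M / x := by
      rw [lt_div_iff₀ hx0]
      linarith
    linarith
  have hQM : Q ≤ M + 1 := by
    have := div_le_self hM'.le hx1
    linarith
  have hxQ : x = M / (Q - 1) := by
    rw [hQ, add_sub_cancel_left]
    field_simp
  obtain ⟨p, hGp, hpQ⟩ := exists_between hGQ
  have hp1 : 1 < p := hG1.trans hGp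
  have hgap : 0 < (M : ℝ) / (p - 1) - x := by
    rw [hxQ, sub_pos]
    apply div_lt_div_of_pos_left hM' <;> linarith
  obtain ⟨N, hN⟩ := exists_pow_lt_of_lt_one hgap (inv_lt_one_of_one_lt₀ hp1)
  let c : ℕ → Digits M := fun n => concat (fun _ => Fin.last M) n (balanced M)
  have hrefl : ∀ n, reflect (c n) = concat (fun _ => 0) n (reflect (balanced M)) := by
    intro n
    funext i
    by_cases hi : i < n <;> simp [reflect, c, concat, hi]
  have hshift : ∀ n j, j ≤ n → shift j (c n) = c (n - j) := by
    intro n j hj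
    funext i
    by_cases hi : i + j < n
    · have hi' : i < n - j := by omega
      simp [c, concat, hi, hi']
    · have hi' : ¬ i < n - j := by omega
      simp only [shift, c, concat, hi, hi', if_false]
      congr 1
      omega
  refine infinite_Ubases_of_family (Set.Ici_infinite N) c (fun n _ m _ hnm he => ?_) fun n hn => ?_
  · have h := congrArg (fun d : Digits M => (d n : ℕ)) he
    simp only [c, concat_of_le _ _ le_rfl, concat_of_lt _ _ hnm, Nat.sub_self, balanced_zero,
      Fin.val_last] at h
    omega
  · obtain ⟨q, ⟨hq1, hq2⟩, hq⟩ := exists_base (x := x) hp1 hpQ.le (c n)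
      (by rw [hxQ]; exact piQ_le (hp1.trans hpQ) _) (by
        have h1 := piQ_reflect hp1 (c n)
        rw [hrefl, piQ_zeros_concat hp1] at h1
        have h2 : piQ M p (reflect (balanced M)) / p ^ n ≤ p⁻¹ ^ N := by
          rw [inv_pow, ← one_div]
          have h3 := (piQ_balanced_lt hM hGp).2.le
          have h4 : p ^ N ≤ p ^ n := pow_le_pow_right₀ hp1.le hn
          have : 0 < p ^ N := by positivity
          gcongr
        linarith)
    have h1q : 1 < q := hp1.trans_le hq1
    have hGq : qG M < q := hGp.trans_le hq1
    refine ⟨q, ⟨h1q, hq2.trans hQM⟩, hq, mem_UqSym h1q (fun i hi => ?_) fun i hi => ?_⟩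
    · have hin : n ≤ i := by
        by_contra! hlt
        simp [c, concat_of_lt _ _ hlt] at hi
      rw [shift_concat_of_le _ _ (by omega)]
      exact (piQ_shift_balanced_lt hM hGq _).1
    · rcases lt_or_ge n (i + 1) with hin | hin
      · rw [shift_concat_of_le _ _ (by omega)]
        exact (piQ_shift_balanced_lt hM hGq _).2
      · rw [hshift n _ hin, hrefl, piQ_zeros_concat h1q]
        have h3 := (piQ_balanced_lt hM hGq).2
        have h4 := piQ_nonneg h1q (reflect (balanced M))
        exact (div_le_self h4 (one_le_pow₀ h1q.le)).trans_lt h3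

lemma inv_pow_sub_ge {q Q : ℝ} (hq : 0 < q) (hqQ : q ≤ Q) (s : ℕ) :
    (Q - q) / Q ^ (s + 2) ≤ 1 / q ^ (s + 1) - 1 / Q ^ (s + 1) := by
  have hQ : 0 < Q := hq.trans_le hqQ
  have h1 : 1 / (Q ^ s * q) ≤ 1 / q ^ (s + 1) := by
    rw [pow_succ]
    gcongr
  have h2 : (Q - q) / Q ^ (s + 2) ≤ 1 / (Q ^ s * q) - 1 / Q ^ (s + 1) := by
    have : 1 / (Q ^ s * q) - 1 / Q ^ (s + 1) = (Q - q) / (Q ^ (s + 1) * q) := by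
      field_simp
      ring
    rw [this, show s + 2 = s + 1 + 1 from rfl, pow_succ Q (s + 1)]
    have : 0 ≤ Q - q := by linarith
    gcongr
  linarith

lemma infinite_Ubases_of_lt_one {M : ℕ} (hM : 0 < M) {x : ℝ} (hx0 : 0 < x) (hx1 : x < 1) :
    (Ubases M x).Infinite := by
  obtain ⟨hG1, hG2⟩ := qG_bounds hM
  have hM' : (1 : ℝ) ≤ M := by exact_mod_cast hM
  set Q : ℝ := M + 1 with hQ
  have hQ1 : 1 < Q := by linarith
  have hQd : (M : ℝ) / (Q - 1) = 1 := by
    rw [hQ, add_sub_cancel_right]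
    exact div_self (by linarith)
  obtain ⟨d, hd, hpos⟩ := exists_expansion_pos (M := M) hQ1 le_rfl (y := x)
    ⟨hx0, by rw [hQd]; exact hx1.le⟩
  have hinf : ∀ N, ∃ R, N ≤ R ∧ 0 < (d R : ℕ) := by
    intro N
    obtain ⟨i, hi⟩ := exists_digit_pos (hpos N)
    exact ⟨i + N, by omega, hi⟩
  obtain ⟨s, -, hs⟩ := hinf 0
  obtain ⟨R, hsR, hR⟩ := hinf (s + 6)
  obtain ⟨p, hGp, hpQ⟩ := exists_between hG2
  have hp1 : 1 < p := hG1.trans hGp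
  have hp32 : 3 / 2 < p := by
    have h1 := sq_gt_of_qG_lt hM hGp
    have h2 : (1 : ℝ) ≤ ((M - M / 2 : ℕ) : ℝ) := by exact_mod_cast (by omega : 1 ≤ M - M / 2)
    have h3 : (0 : ℝ) ≤ ((M / 2 : ℕ) : ℝ) := Nat.cast_nonneg _
    nlinarith
  have hgap : 0 < (Q - p) / Q ^ (s + 2) := by
    have : 0 < Q - p := by linarith
    positivity
  obtain ⟨N, hN⟩ := exists_pow_lt_of_lt_one hgap (inv_lt_one_of_one_lt₀ hQ1)
  let t : Digits M := concat (fun _ => 0) 1 (balanced M)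
  let c : ℕ → Digits M := fun n => concat d n t
  have hcn : ∀ n, ((c n n : Fin (M + 1)) : ℕ) = 0 := fun n => by
    simp [c, t, concat]
  have hcR : ∀ n i, i < n → c n i = d i := fun n i hi => concat_of_lt _ _ hi
  have hctail : ∀ n j, n + 1 ≤ j → shift j (c n) = shift (j - n - 1) (balanced M) := by
    intro n j hj
    rw [shift_concat_of_le _ _ (by omega), shift_concat_of_le _ _ (by omega)]
  have hbelow : ∀ n, 0 < (d n : ℕ) → piQ M Q (c n) < x := by
    intro n hn
    have h1 := piQ_sub_of_agree hQ1 (hcR n)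
    rw [hctail n _ le_rfl, hcn, hd] at h1
    have h2 := (piQ_shift_balanced_lt hM hG2 (n + 1 - n - 1)).1
    have h3 := hpos (n + 1)
    have h4 : (1 : ℝ) ≤ (d n : ℕ) := by exact_mod_cast hn
    have : 0 < x - piQ M Q (c n) := by
      rw [h1]
      apply div_pos _ (by positivity)
      push_cast
      linarith
    linarith
  have habove : ∀ n, x ≤ piQ M Q (c n) + 1 / Q ^ n := by
    intro n
    rw [← hd, piQ_split hQ1 d n, piQ_split hQ1 (c n) n, sum_concat _ _ le_rfl]
    have h1 := piQ_nonneg hQ1 (shift n (c n))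
    have h2 := piQ_le hQ1 (shift n d)
    rw [hQd] at h2
    have h3 : piQ M Q (shift n d) / Q ^ n ≤ 1 / Q ^ n := by gcongr
    have h4 : 0 ≤ piQ M Q (shift n (c n)) / Q ^ n := by positivity
    linarith
  have hgrow : ∀ n, s < n → ∀ q, 1 < q → q ≤ Q →
      piQ M Q (c n) + (Q - q) / Q ^ (s + 2) ≤ piQ M q (c n) := by
    intro n hn q hq hqQ
    have h1 := piQ_sub_ge hq hqQ (c n) s
    rw [hcR n s hn] at h1
    have h2 := inv_pow_sub_ge (by linarith) hqQ s
    have h3 : (1 : ℝ) ≤ (d s : ℕ) := by exact_mod_cast hs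
    have h4 : 0 ≤ (Q - q) / Q ^ (s + 2) := by
      have : 0 ≤ Q - q := by linarith
      positivity
    have h5 : ((d s : ℕ) : ℝ) / q ^ (s + 1) - (d s : ℕ) / Q ^ (s + 1) =
        (d s : ℕ) * (1 / q ^ (s + 1) - 1 / Q ^ (s + 1)) := by ring
    rw [h5] at h1
    nlinarith
  have hS : {n | N + R + s + 5 ≤ n ∧ 0 < (d n : ℕ)}.Infinite := by
    refine Set.infinite_of_forall_exists_gt fun k => ?_
    obtain ⟨r, hr, hr'⟩ := hinf (N + R + s + 5 + k + 1)
    exact ⟨r, ⟨by omega, hr'⟩, by omega⟩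
  refine infinite_Ubases_of_family hS c (fun n hn m hm hnm he => ?_) fun n hn => ?_
  · have h := congrArg (fun d : Digits M => (d n : ℕ)) he
    simp only [hcn, hcR m n hnm] at h
    exact hn.2.ne h
  · obtain ⟨hn1, hn2⟩ := hn
    obtain ⟨q, ⟨hq1, hq2⟩, hq⟩ := exists_base (x := x) hp1 hpQ.le (c n) (hbelow n hn2).le (by
      have h1 := hgrow n (by omega) p hp1 hpQ.le
      have h2 := habove n
      have h3 : 1 / Q ^ n ≤ Q⁻¹ ^ N := by
        rw [inv_pow, ← one_div]
        have h4 : Q ^ N ≤ Q ^ n := pow_le_pow_right₀ hQ1.le (by omega)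
        have : 0 < Q ^ N := by positivity
        gcongr
      linarith)
    have h1q : 1 < q := hp1.trans_le hq1
    have hGq : qG M < q := hGp.trans_le hq1
    have hqQ : q < Q := by
      refine lt_of_le_of_ne hq2 fun h => ?_
      have := hbelow n hn2
      rw [← h, hq] at this
      exact this.false
    refine ⟨q, ⟨h1q, hq2⟩, hq, mem_UqSym h1q (fun i hi => ?_) fun i hi => ?_⟩
    · rcases lt_or_ge i n with hin | hin
      · have h1 := piQ_split h1q (c n) (i + 1)
        have h2 := piQ_split hQ1 d (i + 1)
        have h3 := piQ_le hQ1 (shift (i + 1) d)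
        have h4 := sum_digits_anti h1q hq2 d (i + 1)
        rw [sum_concat _ _ (by omega), hq] at h1
        rw [hd] at h2
        rw [hQd] at h3
        have h5 : piQ M Q (shift (i + 1) d) / Q ^ (i + 1) ≤ 1 / Q ^ (i + 1) := by gcongr
        have h6 : piQ M q (shift (i + 1) (c n)) / q ^ (i + 1) ≤ 1 / Q ^ (i + 1) := by linarith
        have h7 : 1 / Q ^ (i + 1) < 1 / q ^ (i + 1) := by gcongr
        have h8 := h6.trans_lt h7
        rwa [div_lt_div_iff_of_pos_right (by positivity)] at h8
      · rw [hctail n _ (by omega)]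
        exact (piQ_shift_balanced_lt hM hGq _).1
    · rcases lt_trichotomy i n with hin | rfl | hin
      · obtain ⟨r, hr1, hr2, hr3⟩ : ∃ r, i + 1 ≤ r ∧ r + s + 4 ≤ n + (i + 1) ∧ 0 < (c n r : ℕ) := by
          by_cases his : i < s + 6
          · refine ⟨R, ?_, by omega, ?_⟩
            · rcases Nat.lt_or_ge i R with h | h <;> omega
            · rw [hcR n R (by omega)]
              exact hR
          · refine ⟨n + 2, by omega, by omega, ?_⟩
            have : c n (n + 2) = balanced M 1 := by
              simp [c, t, concat]
            rw [this, balanced_one]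
            omega
        have h1 := le_piQ h1q (shift (i + 1) (c n)) (r - (i + 1))
        rw [shift_apply, Nat.sub_add_cancel hr1] at h1
        have h2 : (1 : ℝ) ≤ (c n r : ℕ) := by exact_mod_cast hr3
        have h3 : 1 / Q ^ (n - s - 3) ≤ (c n r : ℕ) / q ^ (r - (i + 1) + 1) := by
          have h5 : q ^ (r - (i + 1) + 1) ≤ Q ^ (n - s - 3) :=
            (pow_le_pow_left₀ (by linarith) hq2 _).trans (pow_le_pow_right₀ hQ1.le (by omega))
          have : 0 < q ^ (r - (i + 1) + 1) := by positivity
          gcongr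
        have h4 := hgrow n (by omega) q h1q hq2
        have h5 := habove n
        have h6 : (Q - q) / Q ^ (s + 2) ≤ 1 / Q ^ n := by linarith
        have h7 : Q * (Q - q) ≤ 1 / Q ^ (n - s - 3) := by
          have hpow : Q ^ n = Q ^ (s + 2) * (Q * Q ^ (n - s - 3)) := by
            rw [← pow_succ', ← pow_add]
            congr 1
            omega
          rw [hpow, div_le_div_iff₀ (by positivity) (by positivity)] at h6
          rw [le_div_iff₀ (by positivity)]
          have h8 : 0 < Q ^ (s + 2) := by positivity
          nlinarith
        have h8 : (M : ℝ) / (q - 1) - 1 < Q * (Q - q) := by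
          have h9 : (M : ℝ) / (q - 1) - 1 = (Q - q) / (q - 1) := by
            have : q - 1 ≠ 0 := by linarith
            field_simp
            ring
          rw [h9, div_lt_iff₀ (by linarith)]
          nlinarith [mul_pos (show 0 < Q - q by linarith)
            (show 0 < Q * (q - 1) - 1 by nlinarith)]
        rw [piQ_reflect h1q]
        linarith
      · simp [hcn] at hi
      · rw [hctail n _ (by omega)]
        exact (piQ_shift_balanced_lt hM hGq _).2

/-- All shifts of `c` lie between `reflect c` and `c` in the lexicographic order. -/
def Admissible {M : ℕ} (c : Digits M) : Prop :=
  ∀ n, lexLe (shift n c) c ∧ lexLe (reflect (shift n c)) c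

/-- No proper shift of `c` equals its reflection. -/
def NonReflecting {M : ℕ} (c : Digits M) : Prop := ∀ n, 0 < n → shift n c ≠ reflect c

lemma lexLe_reflect_left {M : ℕ} {c d : Digits M} (h : lexLe (reflect c) d) :
    lexLe (reflect d) c := by
  rw [lexLe_iff, lexValue_reflect] at h ⊢
  linarith

lemma lexLt_reflect_left {M : ℕ} {c d : Digits M} (h : lexLt (reflect c) d) :
    lexLt (reflect d) c := by
  rw [lexLt_iff, lexValue_reflect] at h ⊢
  linarith

lemma lexLe_trans {M : ℕ} {a b c : Digits M} (h1 : lexLe a b) (h2 : lexLe b c) : lexLe a c := by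
  rw [lexLe_iff] at *
  exact h1.trans h2

lemma lexLe_antisymm {M : ℕ} {a b : Digits M} (h1 : lexLe a b) (h2 : lexLe b a) : a = b := by
  rw [lexLe_iff] at *
  exact lexValue_injective (h1.antisymm h2)

lemma not_lexLe_of_lexLt {M : ℕ} {a b : Digits M} (h : lexLt a b) : ¬ lexLe b a := by
  rw [lexLe_iff, not_le]
  exact lexLt_iff.mp h

lemma isClosed_admissible (M : ℕ) : IsClosed {c : Digits M | Admissible c} := by
  simp only [Admissible, lexLe_iff, Set.ofPred_forall]
  refine isClosed_iInter fun n => ?_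
  exact (isClosed_le (continuous_lexValue.comp (continuous_shift n)) continuous_lexValue).and
    (isClosed_le (continuous_lexValue.comp (continuous_reflect.comp (continuous_shift n)))
      continuous_lexValue)

lemma exists_agree_of_mem_closure {M : ℕ} {S : Set (Digits M)} {c : Digits M} (hc : c ∈ closure S)
    (n : ℕ) : ∃ w ∈ S, ∀ i < n, w i = c i := by
  obtain ⟨w, hw1, hw2⟩ := mem_closure_iff.mp hc (Set.pi (Set.Iio n) fun i => {c i})
    (isOpen_set_pi (Set.finite_Iio n) fun _ _ => isOpen_discrete _) (fun i _ => rfl)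
  exact ⟨w, hw2, fun i hi => hw1 i hi⟩

lemma lexLe_shift_of_agree {M : ℕ} {u c : Digits M} {n : ℕ} (h : ∀ i < n, u i = c i)
    (hle : lexLe u c) : lexLe (shift n u) (shift n c) := by
  rcases hle with rfl | ⟨k, hk, hlt⟩
  · exact Or.inl rfl
  · have hkn : n ≤ k := by
      by_contra! hkn
      rw [h k hkn] at hlt
      exact hlt.false
    refine Or.inr ⟨k - n, fun i hi => hk _ (by omega), ?_⟩
    simpa [Nat.sub_add_cancel hkn] using hlt

lemma piQ_shift_le_one {M : ℕ} {q : ℝ} (hq : 1 < q) {c d : Digits M}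
    (hd : ∀ j, lexLe (shift j d) c) (hc : piQ M q c ≤ 1) (j : ℕ) : piQ M q (shift j d) ≤ 1 := by
  have hbdd : BddAbove (Set.range fun j => piQ M q (shift j d)) := by
    refine ⟨M / (q - 1), ?_⟩
    rintro _ ⟨j, rfl⟩
    exact piQ_le hq _
  set s := ⨆ j, piQ M q (shift j d) with hs
  have hle : ∀ j, piQ M q (shift j d) ≤ s := le_ciSup hbdd
  suffices s ≤ 1 from (hle j).trans this
  by_contra! h1
  have h0 : 0 < q := by linarith
  have : s ≤ 1 + (s - 1) / q := by
    refine ciSup_le fun j => ?_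
    have hpos : 0 ≤ (s - 1) / q := by
      have : 0 ≤ s - 1 := by linarith
      positivity
    rcases hd j with h | ⟨n, hn, hlt⟩
    · rw [h]
      linarith
    · have h2 := piQ_sub_of_agree hq hn
      rw [shift_shift] at h2
      have h3 : ((shift j d n : ℕ) : ℝ) + 1 ≤ (c n : ℕ) := by exact_mod_cast hlt
      have h4 := hle (n + 1 + j)
      have h5 := piQ_nonneg hq (shift (n + 1) c)
      have h6 : (1 - s) / q ^ (n + 1) ≤ piQ M q c - piQ M q (shift j d) := by
        rw [h2]
        gcongr
        linarith
      have h7 : (s - 1) / q ^ (n + 1) ≤ (s - 1) / q := by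
        have : 0 ≤ s - 1 := by linarith
        gcongr
        exact le_self_pow₀ hq.le (by omega)
      have h8 : (1 - s) / q ^ (n + 1) = - ((s - 1) / q ^ (n + 1)) := by ring
      linarith
  have h2 : (s - 1) / q < s - 1 := div_lt_self (by linarith) hq
  linarith

lemma piQ_lt_one {M : ℕ} {q : ℝ} (hq : 1 < q) {c d : Digits M}
    (hd : ∀ j, lexLe (shift j d) c) (hc : piQ M q c ≤ 1) (hlt : lexLt d c)
    (hpos : ∀ n, 0 < piQ M q (shift n c)) : piQ M q d < 1 := by
  obtain ⟨n, hn, hlt⟩ := hlt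
  have h0 : 0 < q := by linarith
  have h1 := piQ_shift_le_one hq hd hc (n + 1)
  have h2 := piQ_sub_of_agree hq hn
  have h3 : ((d n : ℕ) : ℝ) + 1 ≤ (c n : ℕ) := by exact_mod_cast hlt
  have h4 := hpos (n + 1)
  have : 0 < piQ M q c - piQ M q d := by
    rw [h2]
    apply div_pos _ (by positivity)
    linarith
  linarith

lemma eq_last_of_lexLe {M : ℕ} {c : Digits M} (h : lexLe (fun _ => Fin.last M) c) :
    c = fun _ => Fin.last M := by
  rcases h with h | ⟨n, -, hn⟩
  · exact h.symm
  · exact absurd hn (Fin.le_last _).not_gt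

lemma Admissible.exists_digit_pos {M : ℕ} {c : Digits M} (hc : Admissible c)
    (hp : ∀ n, 0 < n → shift n c ≠ c) (N : ℕ) : ∃ i, N ≤ i ∧ (0 : ℕ) < c i := by
  by_contra! h
  have h1 : reflect (shift N c) = fun _ => Fin.last M := by
    funext i
    apply Fin.ext
    rw [reflect_apply_val, shift_apply, Nat.le_zero.mp (h (i + N) (by omega))]
    simp
  have h2 := (hc N).2
  rw [h1] at h2
  apply hp 1 one_pos
  rw [eq_last_of_lexLe h2]
  rfl

lemma exists_base_one_le_piQ {M : ℕ} {q : ℝ} (hq : 1 < q) {c : Digits M} {a b : ℕ} (hab : a < b)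
    (ha : (0 : ℕ) < c a) (hb : (0 : ℕ) < c b) : ∃ p, 1 < p ∧ p < q ∧ 1 ≤ piQ M p c := by
  have hev : ∀ᶠ p : ℝ in nhdsWithin 1 (Set.Ioi 1), p ^ (b + 1) < 2 := by
    have ht : Filter.Tendsto (fun p : ℝ => p ^ (b + 1)) (nhdsWithin 1 (Set.Ioi 1)) (nhds 1) := by
      have := (continuous_pow (M := ℝ) (b + 1)).tendsto 1
      rw [one_pow] at this
      exact this.mono_left nhdsWithin_le_nhds
    exact ht.eventually (gt_mem_nhds (by norm_num))
  obtain ⟨p, hp2, hp1, hpq⟩ := (hev.and (Ioo_mem_nhdsGT hq)).exists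
  refine ⟨p, hp1, hpq, ?_⟩
  have h0 : 0 < p := by linarith
  have h1 := (summable_digits hp1 c).sum_le_tsum {a, b} (fun i _ => by positivity)
  rw [Finset.sum_pair hab.ne] at h1
  have hterm : ∀ i, i ≤ b → (0 : ℕ) < c i → 1 / 2 ≤ ((c i : ℕ) : ℝ) / p ^ (i + 1) := by
    intro i hi hci
    have h2 : (1 : ℝ) ≤ (c i : ℕ) := by exact_mod_cast hci
    have h3 : p ^ (i + 1) ≤ 2 :=
      (pow_le_pow_right₀ hp1.le (by omega)).trans hp2.le
    gcongr
  have h2 := hterm a hab.le ha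
  have h3 := hterm b le_rfl hb
  rw [piQ]
  linarith

lemma Admissible.exists_mem_Ubases_one {M : ℕ} {q : ℝ} (hq : 1 < q) (hqM : q ≤ M + 1)
    {c : Digits M} (hc : Admissible c) (hp : ∀ n, 0 < n → shift n c ≠ c) (hcq : piQ M q c ≤ 1) :
    ∃ p ∈ Ubases M 1, p ≤ q := by
  obtain ⟨a, -, ha⟩ := hc.exists_digit_pos hp 0
  obtain ⟨b, hab, hb⟩ := hc.exists_digit_pos hp (a + 1)
  obtain ⟨r, hr1, hrq, hr⟩ := exists_base_one_le_piQ hq hab ha hb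
  obtain ⟨p, ⟨hp1, hp2⟩, hpc⟩ := exists_base hr1 hrq.le c hcq hr
  have h1p : 1 < p := hr1.trans_le hp1
  have hpos : ∀ n, 0 < piQ M p (shift n c) := by
    intro n
    obtain ⟨i, hi, hci⟩ := hc.exists_digit_pos hp n
    refine piQ_pos_of_digit h1p _ (i := i - n) ?_
    rwa [shift_apply, Nat.sub_add_cancel hi]
  have hmem : c ∈ UqSym M p := by
    refine mem_UqSym h1p (fun i _ => ?_) fun i _ => ?_
    · refine piQ_lt_one h1p (fun j => ?_) hpc.le ?_ hpos
      · rw [shift_shift]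
        exact (hc _).1
      · exact (hc (i + 1)).1.resolve_left (hp _ (by omega))
    · refine piQ_lt_one h1p (fun j => ?_) hpc.le ?_ hpos
      · rw [← reflect_shift, shift_shift]
        exact (hc _).2
      · refine (hc (i + 1)).2.resolve_left fun h => hp (i + 1 + (i + 1)) (by omega) ?_
        rw [← shift_shift]
        nth_rewrite 2 [← h]
        rw [← reflect_reflect (shift (i + 1) c), h, reflect_reflect, ← reflect_shift, h]
  exact ⟨p, ⟨⟨h1p, hp2.trans hqM⟩, c, hpc, fun e he => hmem e (he.trans hpc.symm)⟩, hp2⟩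

lemma lexLt_reflect_of_val {M : ℕ} {c d : Digits M} {i : ℕ} (h : ∀ t < i, (d t : ℕ) = M - c t)
    (hi : M - (c i : ℕ) < d i) : lexLt (reflect c) d :=
  ⟨i, fun t ht => Fin.ext (by rw [reflect_apply_val, h t ht]),
    by rw [Fin.lt_def, reflect_apply_val]; exact hi⟩

/-- `i` is the first place where `shift j c` differs from `reflect c`, and `shift j c` is larger
there. -/
def ExceedsReflectAt {M : ℕ} (c : Digits M) (j i : ℕ) : Prop :=
  (∀ t < i, (c (t + j) : ℕ) = M - c t) ∧ M - (c i : ℕ) < c (i + j)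

lemma Admissible.exists_exceedsReflectAt {M : ℕ} {c : Digits M} (hc : Admissible c)
    {j : ℕ} (hj : shift j c ≠ reflect c) : ∃ i, ExceedsReflectAt c j i := by
  obtain ⟨i, h1, h2⟩ := (lexLe_reflect_left (hc j).2).resolve_left hj.symm
  refine ⟨i, fun t ht => ?_, ?_⟩
  · rw [← reflect_apply_val, h1 t ht, shift_apply]
  · rw [← reflect_apply_val]
    exact h2

lemma Admissible.exists_uniform_exceedsReflectAt {M : ℕ} {c : Digits M} (hc : Admissible c)
    (hr : NonReflecting c) {m : ℕ} (hm : 0 < m) (hper : shift m c = c) :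
    ∃ L, ∀ j, ∃ i < L, ExceedsReflectAt c j i := by
  have hex : ∀ j, ∃ i, ExceedsReflectAt c j i := by
    intro j
    refine hc.exists_exceedsReflectAt ?_
    rcases Nat.eq_zero_or_pos j with rfl | hj
    · rw [shift_zero]
      nth_rewrite 1 [← hper]
      exact hr m hm
    · exact hr j hj
  choose g hg using hex
  have hp : Function.Periodic c m := fun i => congrFun hper i
  have hmod : ∀ t j, c (t + j) = c (t + j % m) := by
    intro t j
    rw [← hp.map_mod_nat (t + j), ← hp.map_mod_nat (t + j % m), Nat.add_mod_mod]
  refine ⟨(Finset.range m).sup g + 1, fun j => ⟨g (j % m), ?_, ?_⟩⟩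
  · exact Nat.lt_succ_of_le (Finset.le_sup (Finset.mem_range.mpr (Nat.mod_lt j hm)))
  · have h := hg (j % m)
    exact ⟨fun t ht => by rw [hmod]; exact h.1 t ht, by rw [hmod]; exact h.2⟩

lemma Admissible.exists_prefix {M : ℕ} {c : Digits M} (hc : Admissible c)
    (hex : ∀ j, ∃ i, ExceedsReflectAt c j i) (I : ℕ) :
    ∃ l, I ≤ l ∧ ∀ j < l, ∃ i, i + j < l ∧ ExceedsReflectAt c j i := by
  by_cases h : ∀ j < I, ∃ i, i + j < I ∧ ExceedsReflectAt c j i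
  · exact ⟨I, le_rfl, h⟩
  push Not at h
  obtain ⟨j, ⟨hjI, hj⟩, hmin⟩ : ∃ j, (j < I ∧ ∀ i, i + j < I → ¬ ExceedsReflectAt c j i) ∧
      ∀ k < j, ¬ (k < I ∧ ∀ i, i + k < I → ¬ ExceedsReflectAt c k i) :=
    ⟨Nat.find h, Nat.find_spec h, fun k hk => Nat.find_min h hk⟩
  obtain ⟨i, hi⟩ := hex j
  have hIi : I ≤ i + j := by
    by_contra! hlt
    exact hj i hlt hi
  refine ⟨i + j + 1, by omega, fun k hk => ?_⟩
  rcases lt_trichotomy k j with hkj | rfl | hkj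
  · have := hmin k hkj
    push Not at this
    obtain ⟨i', h1, h2⟩ := this (by omega)
    exact ⟨i', by omega, h2⟩
  · exact ⟨i, by omega, hi⟩
  · obtain ⟨i', hi'⟩ := hex k
    refine ⟨i', ?_, hi'⟩
    by_contra! hlt
    obtain ⟨e, he⟩ : ∃ e, i = e + (k - j) := ⟨i - (k - j), by omega⟩
    refine not_lexLe_of_lexLt (a := c) (b := shift (k - j) c) ⟨e, fun t ht => ?_, ?_⟩ (hc _).1
    · have h1 := hi'.1 t (by omega)
      have h2 := hi.1 (t + (k - j)) (by omega)
      rw [show t + (k - j) + j = t + k by omega] at h2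
      have h3 := digit_le c t
      have h4 := digit_le c (t + (k - j))
      apply Fin.ext
      rw [shift_apply]
      omega
    · have h1 := hi'.1 e (by omega)
      have h2 := hi.2
      rw [show i + j = e + k by omega, he] at h2
      have h3 := digit_le c e
      have h4 := digit_le c (e + (k - j))
      rw [Fin.lt_def, shift_apply]
      omega

/-- The periodic sequence `(c_1 … c_{l-1} (c_l - 1))^∞`. -/
def lowerPeriodic {M : ℕ} (c : Digits M) (l : ℕ) : Digits M := fun i =>
  if i % l = l - 1 then ⟨(c (l - 1) : ℕ) - 1, by omega⟩ else c (i % l)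

lemma lowerPeriodic_of_lt {M : ℕ} (c : Digits M) {l i : ℕ} (h : i < l - 1) :
    lowerPeriodic c l i = c i := by
  have h1 : i % l = i := Nat.mod_eq_of_lt (by omega)
  rw [lowerPeriodic, h1, if_neg h.ne]

lemma lowerPeriodic_last {M : ℕ} (c : Digits M) {l : ℕ} (hl : 0 < l) :
    ((lowerPeriodic c l (l - 1) : Fin (M + 1)) : ℕ) = (c (l - 1) : ℕ) - 1 := by
  have h1 : (l - 1) % l = l - 1 := Nat.mod_eq_of_lt (by omega)
  rw [lowerPeriodic, if_pos h1]

lemma lowerPeriodic_add {M : ℕ} (c : Digits M) (l i : ℕ) :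
    lowerPeriodic c l (i + l) = lowerPeriodic c l i := by
  simp [lowerPeriodic]

lemma shift_lowerPeriodic_mod {M : ℕ} (c : Digits M) (l j : ℕ) :
    shift j (lowerPeriodic c l) = shift (j % l) (lowerPeriodic c l) := by
  funext i
  simp [lowerPeriodic]

lemma Admissible.exists_lt_of_periodic {M : ℕ} {c : Digits M} (hc : Admissible c)
    (hr : NonReflecting c) {m : ℕ} (hm : 0 < m) (hper : shift m c = c) :
    ∃ c' : Digits M, Admissible c' ∧ NonReflecting c' ∧ lexLt c' c := by
  obtain ⟨L, hL⟩ := hc.exists_uniform_exceedsReflectAt hr hm hper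
  obtain ⟨l, hl, hpre⟩ := hc.exists_prefix (fun j => (hL j).imp fun _ h => h.2) (2 * L + 1)
  have hlast : 0 < (c (l - 1) : ℕ) := by
    obtain ⟨i, hi, h⟩ := hpre (l - 1) (by omega)
    obtain rfl : i = 0 := by omega
    have := h.2
    rw [Nat.zero_add] at this
    omega
  have hlast' := lowerPeriodic_last c (l := l) (by omega)
  have hupper : ∀ j, 0 < j → j < l → lexLt (shift j (lowerPeriodic c l)) (lowerPeriodic c l) := by
    intro j hj hjl
    have key : (∃ n, n + j < l - 1 ∧ (∀ t < n, c (t + j) = c t) ∧ c (n + j) < c n) ∨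
        (∀ t < l - 1 - j, c (t + j) = c t) ∧ c (l - 1) ≤ c (l - 1 - j) := by
      have hlj : l - 1 - j + j = l - 1 := by omega
      rcases (hc j).1 with h | ⟨n, hn, hlt⟩
      · refine Or.inr ⟨fun t _ => congrFun h t, ?_⟩
        have := congrFun h (l - 1 - j)
        rw [shift_apply, hlj] at this
        exact this.le
      · by_cases hnl : n + j < l - 1
        · exact Or.inl ⟨n, hnl, hn, hlt⟩
        · refine Or.inr ⟨fun t ht => hn t (by omega), ?_⟩
          rcases eq_or_lt_of_le (show l - 1 - j ≤ n by omega) with h | h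
          · rw [← h, shift_apply, hlj] at hlt
            exact hlt.le
          · have := hn _ h
            rw [shift_apply, hlj] at this
            exact this.le
    rcases key with ⟨n, hnl, hn, hlt⟩ | ⟨hn, hle⟩
    · refine ⟨n, fun t ht => ?_, ?_⟩
      · rw [shift_apply, lowerPeriodic_of_lt c (by omega), lowerPeriodic_of_lt c (by omega), hn t ht]
      · rwa [shift_apply, lowerPeriodic_of_lt c (by omega), lowerPeriodic_of_lt c (by omega)]
    · refine ⟨l - 1 - j, fun t ht => ?_, ?_⟩
      · rw [shift_apply, lowerPeriodic_of_lt c (by omega), lowerPeriodic_of_lt c (by omega), hn t ht]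
      · rw [Fin.le_def] at hle
        rw [shift_apply, show l - 1 - j + j = l - 1 by omega, Fin.lt_def, hlast',
          lowerPeriodic_of_lt c (by omega)]
        omega
  have hstrict : ∀ j i, i + j < l - 1 → ExceedsReflectAt c j i →
      lexLt (reflect (lowerPeriodic c l)) (shift j (lowerPeriodic c l)) := by
    intro j i hi h
    refine lexLt_reflect_of_val (i := i) (fun t ht => ?_) ?_
    · rw [shift_apply, lowerPeriodic_of_lt c (by omega), lowerPeriodic_of_lt c (by omega)]
      exact h.1 t ht
    · rw [shift_apply, lowerPeriodic_of_lt c (by omega), lowerPeriodic_of_lt c (by omega)]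
      exact h.2
  have hshort : ∀ j, j + L < l →
      lexLt (reflect (lowerPeriodic c l)) (shift j (lowerPeriodic c l)) := by
    intro j hj
    obtain ⟨i, hi, h⟩ := hL j
    exact hstrict j i (by omega) h
  have hlower : ∀ j, j < l →
      lexLt (reflect (lowerPeriodic c l)) (shift j (lowerPeriodic c l)) := by
    intro j hj
    by_cases hjL : j + L < l
    · exact hshort j hjL
    obtain ⟨i, hi, h⟩ := hpre j hj
    by_cases hil : i + j < l - 1
    · exact hstrict j i hil h
    have hij : i + j = l - 1 := by omega
    have hval : ∀ t < i, (shift j (lowerPeriodic c l) t : ℕ) = M - lowerPeriodic c l t := by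
      intro t ht
      rw [shift_apply, lowerPeriodic_of_lt c (by omega), lowerPeriodic_of_lt c (by omega)]
      exact h.1 t ht
    have h2 := h.2
    rw [hij] at h2
    have hvi : (shift j (lowerPeriodic c l) i : ℕ) = c (l - 1) - 1 := by
      rw [shift_apply, hij, hlast']
    have hci : lowerPeriodic c l i = c i := lowerPeriodic_of_lt c (by omega)
    rcases eq_or_lt_of_le (show M - (c i : ℕ) ≤ c (l - 1) - 1 by omega) with heq | hlt
    · obtain ⟨k, hk1, hk2⟩ := lexLt_reflect_left (hshort (l - j) (by omega))
      have hadd : ∀ t, shift j (lowerPeriodic c l) (t + (l - j)) = lowerPeriodic c l t := by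
        intro t
        rw [shift_apply, show t + (l - j) + j = t + l by omega, lowerPeriodic_add]
      refine lexLt_reflect_of_val (i := k + (l - j)) (fun t ht => ?_) ?_
      · rcases lt_trichotomy t i with hti | rfl | hti
        · exact hval t hti
        · rw [hvi, hci, heq]
        · obtain ⟨t', rfl⟩ : ∃ t', t = t' + (l - j) := ⟨t - (l - j), by omega⟩
          rw [hadd, ← hk1 t' (by omega), reflect_apply_val, shift_apply]
      · rw [hadd]
        rw [Fin.lt_def, reflect_apply_val, shift_apply] at hk2
        exact hk2
    · refine lexLt_reflect_of_val hval ?_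
      rw [hvi, hci]
      exact hlt
  have hl0 : 0 < l := by omega
  refine ⟨lowerPeriodic c l, fun n => ?_, fun n _ => ?_, l - 1, fun i hi => ?_, ?_⟩
  · rw [shift_lowerPeriodic_mod]
    refine ⟨?_, Or.inr (lexLt_reflect_left (hlower _ (Nat.mod_lt n hl0)))⟩
    rcases Nat.eq_zero_or_pos (n % l) with h | h
    · rw [h]
      exact Or.inl rfl
    · exact Or.inr (hupper _ h (Nat.mod_lt n hl0))
  · rw [shift_lowerPeriodic_mod]
    intro h
    have := hlower _ (Nat.mod_lt n hl0)
    rw [h] at this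
    exact not_lexLe_of_lexLt this (Or.inl rfl)
  · exact lowerPeriodic_of_lt c hi
  · rw [Fin.lt_def, hlast']
    omega

lemma Admissible.eq_of_agree {M : ℕ} {c w : Digits M} (hw : Admissible w) {m : ℕ} (hm : 0 < m)
    (hper : shift m c = c) (hagree : ∀ i < m, w i = c i) (hle : lexLe c w) : w = c := by
  rcases hle with h | ⟨n, hn, hlt⟩
  · exact h.symm
  have hper' : ∀ i, c (i + m) = c i := congrFun hper
  have hmn : m ≤ n := by
    by_contra! h
    rw [hagree n h] at hlt
    exact hlt.false
  obtain ⟨k, rfl⟩ : ∃ k, n = k + m := ⟨n - m, by omega⟩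
  refine absurd (hw m).1 (not_lexLe_of_lexLt ⟨k, fun i hi => ?_, ?_⟩)
  · rw [shift_apply, ← hn i (by omega), ← hn (i + m) (by omega), hper']
  · rw [shift_apply, ← hn k (by omega)]
    rwa [hper'] at hlt

/-- A least admissible limit of non-reflecting admissible sequences exists, and is not periodic. -/
lemma exists_aperiodic_admissible_le {M : ℕ} {c : Digits M} (hc : Admissible c)
    (hr : NonReflecting c) :
    ∃ d : Digits M, Admissible d ∧ (∀ n, 0 < n → shift n d ≠ d) ∧ lexLe d c := by
  obtain ⟨d, hd, hmin⟩ := (isClosed_closure (s := {w : Digits M | Admissible w ∧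
    NonReflecting w})).isCompact.exists_isMinOn ⟨c, subset_closure ⟨hc, hr⟩⟩
    continuous_lexValue.continuousOn
  have hmin' : ∀ w, Admissible w → NonReflecting w → lexLe d w := fun w h1 h2 =>
    lexLe_iff.mpr (hmin (subset_closure ⟨h1, h2⟩))
  have hda : Admissible d := closure_minimal (fun w hw => hw.1) (isClosed_admissible M) hd
  refine ⟨d, hda, fun m hm hper => ?_, hmin' c hc hr⟩
  obtain ⟨w, ⟨hw1, hw2⟩, hw⟩ := exists_agree_of_mem_closure hd m
  have hwd := hw1.eq_of_agree hm hper hw (hmin' w hw1 hw2)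
  rw [hwd] at hw2
  obtain ⟨c', h1, h2, h3⟩ := hda.exists_lt_of_periodic hw2 hm hper
  exact not_lexLe_of_lexLt h3 (hmin' c' h1 h2)

lemma exists_tails_lt_one {M : ℕ} {q : ℝ} (hq : 1 < q) (hqM : q ≤ M + 1) {c : Digits M}
    (hc : c ∈ UqSym M q) {i : ℕ} (hi : (c i : ℕ) < M) :
    ∀ n, i + 1 ≤ n → piQ M q (shift n c) < 1 := by
  intro n hn
  induction n, hn using Nat.le_induction with
  | base => exact piQ_shift_lt_one_of_mem_UqSym hq hqM hc hi
  | succ n hn ih =>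
    rcases (digit_le c n).lt_or_eq with h | h
    · exact piQ_shift_lt_one_of_mem_UqSym hq hqM hc h
    · have h1 := piQ_step hq (shift n c)
      rw [shift_shift, shift_apply, Nat.zero_add, h, Nat.add_comm 1 n] at h1
      nlinarith

/-- Some proper shift of a shift of `v` coincides with it. -/
def EventuallyPeriodic {M : ℕ} (v : Digits M) : Prop :=
  ∃ j m, 0 < m ∧ shift (m + j) v = shift j v

lemma exists_digit_lt {M : ℕ} {v : Digits M} (hv : ¬ EventuallyPeriodic v) :
    ∃ i, (v i : ℕ) < M := by
  by_contra! h
  refine hv ⟨0, 1, one_pos, ?_⟩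
  funext i
  exact Fin.ext ((digit_le v _).antisymm (h _) |>.trans ((digit_le v _).antisymm (h _)).symm)

lemma EventuallyPeriodic.reflect {M : ℕ} {v : Digits M} (hv : EventuallyPeriodic v) :
    EventuallyPeriodic (reflect v) := by
  obtain ⟨j, m, hm, h⟩ := hv
  exact ⟨j, m, hm, by rw [← reflect_shift, h, reflect_shift]⟩

lemma eventuallyPeriodic_of_shift {M : ℕ} {v : Digits M} {n : ℕ}
    (hv : EventuallyPeriodic (shift n v)) : EventuallyPeriodic v := by
  obtain ⟨j, m, hm, h⟩ := hv
  rw [shift_shift, shift_shift, Nat.add_assoc] at h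
  exact ⟨j + n, m, hm, h⟩

lemma exists_mem_Ubases_one_le {M : ℕ} {q : ℝ} (hq : 1 < q) (hqM : q ≤ M + 1) {v : Digits M}
    (hv : v ∈ UqSym M q) (hnp : ¬ EventuallyPeriodic v) : ∃ p ∈ Ubases M 1, p ≤ q := by
  obtain ⟨i, hi⟩ := exists_digit_lt hnp
  obtain ⟨k, hk⟩ := exists_digit_lt (v := reflect v) fun h => hnp (by
    simpa using EventuallyPeriodic.reflect h)
  have h1 := exists_tails_lt_one hq hqM hv hi
  have h2 := exists_tails_lt_one hq hqM (reflect_mem_UqSym hq hv) hk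
  let N := max (i + 1) (k + 1)
  let T : Set (Digits M) := {w | ∃ n, N ≤ n ∧ (w = shift n v ∨ w = reflect (shift n v))}
  have hTshift : ∀ m, ∀ w ∈ closure T, shift m w ∈ closure T := by
    intro m w hw
    refine Set.MapsTo.closure (s := T) (t := T) ?_ (continuous_shift m) hw
    rintro w ⟨n, hn, rfl | rfl⟩
    · exact ⟨m + n, by omega, Or.inl (shift_shift m n v)⟩
    · exact ⟨m + n, by omega, Or.inr (by rw [← reflect_shift, shift_shift])⟩
  have hTreflect : ∀ w ∈ closure T, reflect w ∈ closure T := by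
    intro w hw
    refine Set.MapsTo.closure (s := T) (t := T) ?_ continuous_reflect hw
    rintro w ⟨n, hn, rfl | rfl⟩
    · exact ⟨n, hn, Or.inr rfl⟩
    · exact ⟨n, hn, Or.inl (reflect_reflect _)⟩
  have hTle : ∀ w ∈ closure T, piQ M q w ≤ 1 := by
    refine closure_minimal ?_ (isClosed_le (continuous_piQ hq) continuous_const)
    rintro w ⟨n, hn, rfl | rfl⟩
    · exact (h1 n ((le_max_left _ _).trans hn)).le
    · rw [reflect_shift]
      exact (h2 n ((le_max_right _ _).trans hn)).le
  obtain ⟨c, hcT, hmax⟩ := (isClosed_closure (s := T)).isCompact.exists_isMaxOn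
    ⟨shift N v, subset_closure ⟨N, le_rfl, Or.inl rfl⟩⟩ continuous_lexValue.continuousOn
  have hmax' : ∀ w ∈ closure T, lexLe w c := fun w hw => lexLe_iff.mpr (hmax hw)
  have hca : Admissible c := fun n =>
    ⟨hmax' _ (hTshift n c hcT), hmax' _ (hTreflect _ (hTshift n c hcT))⟩
  have hcr : NonReflecting c := by
    intro n hn href
    obtain ⟨u, huT, hu⟩ := exists_agree_of_mem_closure hcT n
    have huc : u ∈ closure T := subset_closure huT
    have hle := lexLe_shift_of_agree hu (hmax' u huc)
    rw [href] at hle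
    have hge := lexLe_reflect_left (hmax' _ (hTreflect _ (hTshift n u huc)))
    have heq : shift n u = reflect c := lexLe_antisymm hle hge
    have hup : EventuallyPeriodic u := by
      refine ⟨n, n + n, by omega, ?_⟩
      rw [← shift_shift, ← shift_shift, heq, ← reflect_shift, href, reflect_reflect, href]
    obtain ⟨m, -, rfl | rfl⟩ := huT
    · exact hnp (eventuallyPeriodic_of_shift hup)
    · refine hnp (eventuallyPeriodic_of_shift (n := m) ?_)
      simpa using hup.reflect
  obtain ⟨d, hda, hdp, hdc⟩ := exists_aperiodic_admissible_le hca hcr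
  refine hda.exists_mem_Ubases_one hq hqM hdp ?_
  exact piQ_shift_le_one hq (fun j => lexLe_trans (hda j).1 hdc) (hTle c hcT) 0

lemma countable_eventuallyPeriodic (M : ℕ) : {v : Digits M | EventuallyPeriodic v}.Countable := by
  have : {v : Digits M | EventuallyPeriodic v} =
      ⋃ j, ⋃ m, {v : Digits M | 0 < m ∧ shift (m + j) v = shift j v} := by
    ext v
    simp [EventuallyPeriodic]
  rw [this]
  refine Set.countable_iUnion fun j => Set.countable_iUnion fun m => ?_
  refine Set.countable_of_injective_of_countable_image
    (f := fun (v : Digits M) (i : Fin (m + j)) => v i) ?_ (Set.to_countable _)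
  rintro v ⟨hm, hv⟩ w ⟨-, hw⟩ hvw
  funext i
  induction i using Nat.strong_induction_on with
  | _ i ih =>
    by_cases hi : i < m + j
    · exact congrFun hvw ⟨i, hi⟩
    · have h1 := congrFun hv (i - (m + j))
      have h2 := congrFun hw (i - (m + j))
      simp only [shift_apply, show i - (m + j) + (m + j) = i by omega] at h1 h2
      rw [h1, h2]
      exact ih _ (by omega)

lemma piQ_last {M : ℕ} {q : ℝ} (hq : 1 < q) : piQ M q (fun _ => Fin.last M) = M / (q - 1) := by
  rw [piQ, ← (hasSum_const_digit hq (M : ℝ)).tsum_eq]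
  simp

lemma top_mem_Ubases_one {M : ℕ} (hM : 0 < M) : (M : ℝ) + 1 ∈ Ubases M 1 := by
  have hM' : (0 : ℝ) < M := by exact_mod_cast hM
  have hq : (1 : ℝ) < M + 1 := by linarith
  have h1 : piQ M ((M : ℝ) + 1) (fun _ => Fin.last M) = 1 := by
    rw [piQ_last hq, add_sub_cancel_right, div_self hM'.ne']
  have h2 : (fun _ => Fin.last M) ∈ UqSym M ((M : ℝ) + 1) := by
    refine mem_UqSym hq (fun i hi => absurd hi (by simp)) fun i _ => ?_
    have : piQ M ((M : ℝ) + 1) (shift (i + 1) fun _ => Fin.last M) = 1 := h1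
    rw [piQ_reflect hq, this, add_sub_cancel_right, div_self hM'.ne']
    norm_num
  exact ⟨⟨hq, le_rfl⟩, _, h1, fun e he => h2 e (he.trans h1.symm)⟩

lemma le_of_mem_Ubases_one {M : ℕ} (hM : 0 < M) {q : ℝ} (hq : q ∈ Ubases M 1) :
    1 + (M : ℝ) / 2 ≤ q := by
  have hM' : (0 : ℝ) < M := by exact_mod_cast hM
  obtain ⟨⟨h1, h2⟩, c, hc, hu⟩ := hq
  have hc' : c ∈ UqSym M q := fun e he => hu e (he.trans hc)
  have hq1 : 0 < q - 1 := by linarith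
  suffices (M : ℝ) / (q - 1) < 2 by
    rw [div_lt_iff₀ hq1] at this
    linarith
  by_cases h : ∃ i, (c i : ℕ) < M
  · obtain ⟨i, hi⟩ := h
    obtain ⟨k, hk⟩ := exists_digit_pos (q := q) (d := c) (by rw [hc]; exact one_pos)
    have hk' : (reflect c k : ℕ) < M := by
      rw [reflect_apply_val]
      omega
    have h3 := exists_tails_lt_one h1 h2 hc' hi (i + 1 + (k + 1)) (by omega)
    have h4 := exists_tails_lt_one h1 h2 (reflect_mem_UqSym h1 hc') hk' (i + 1 + (k + 1)) (by omega)
    rw [← reflect_shift, piQ_reflect h1] at h4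
    linarith
  · have h3 : c = fun _ => Fin.last M := by
      push Not at h
      funext i
      exact Fin.ext ((digit_le c i).antisymm (h i))
    rw [h3, piQ_last h1] at hc
    linarith

lemma qKL_le {M : ℕ} {q : ℝ} (hq : q ∈ Ubases M 1) : qKL M ≤ q :=
  csInf_le ⟨1, fun _ h => h.1.1.le⟩ hq

lemma one_lt_qKL {M : ℕ} (hM : 0 < M) : 1 < qKL M := by
  have hM' : (0 : ℝ) < M := by exact_mod_cast hM
  have h : 1 + (M : ℝ) / 2 ≤ qKL M :=
    le_csInf ⟨_, top_mem_Ubases_one hM⟩ fun _ hq => le_of_mem_Ubases_one hM hq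
  linarith

lemma countable_Ubases {M : ℕ} (hM : 0 < M) {x : ℝ} (hx : xKL M ≤ x) :
    (Ubases M x).Countable := by
  have hM' : (0 : ℝ) < M := by exact_mod_cast hM
  have hK := one_lt_qKL hM
  have hle : ∀ q ∈ Ubases M x, q ≤ qKL M := by
    rintro q ⟨⟨h1, -⟩, c, hc, -⟩
    have h3 := piQ_le h1 c
    rw [hc] at h3
    have h4 := hx.trans h3
    rw [xKL, div_le_div_iff_of_pos_left hM' (by linarith) (by linarith)] at h4
    linarith
  have hx0 : 0 < x := (div_pos hM' (by linarith)).trans_le hx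
  suffices (Ubases M x \ {qKL M}).Countable from
    (this.union (Set.countable_singleton (qKL M))).mono fun q hq => by
      by_cases h : q = qKL M
      · exact Or.inr h
      · exact Or.inl ⟨hq, h⟩
  choose! f hf hu using fun (q : ℝ) (hq : q ∈ Ubases M x) => hq.2
  refine Set.MapsTo.countable_of_injOn (f := f) (t := {v | EventuallyPeriodic v}) ?_ ?_
    (countable_eventuallyPeriodic M)
  · rintro q ⟨hq, hne⟩
    by_contra hnp
    obtain ⟨p, hp, hpq⟩ := exists_mem_Ubases_one_le hq.1.1 hq.1.2
      (fun e he => hu q hq e (he.trans (hf q hq))) hnp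
    exact hne ((hle q hq).antisymm ((qKL_le hp).trans hpq))
  · rintro p ⟨hp, -⟩ q ⟨hq, -⟩ hpq
    have h1 : piQ M p (f p) = x := hf p hp
    have h2 : piQ M q (f p) = x := by rw [hpq]; exact hf q hq
    obtain ⟨i, hi⟩ := exists_digit_pos (h1.symm ▸ hx0)
    rcases lt_trichotomy p q with h | h | h
    · exact absurd (h2.trans h1.symm) (piQ_strict_anti hp.1.1 h _ hi).ne
    · exact h
    · exact absurd (h1.trans h2.symm) (piQ_strict_anti hq.1.1 h _ hi).ne

/-- For every `0 < x < x_G` the set `𝒰(x)` is infinite; moreover for every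
`x ∈ [x_KL, x_G)` it is countably infinite. -/
theorem Ubases_infinite_and_countable (M : ℕ) (hM : 0 < M) :
    (∀ x : ℝ, 0 < x → x < xG M → (Ubases M x).Infinite) ∧
    (∀ x ∈ Set.Ico (xKL M) (xG M), (Ubases M x).Countable ∧ (Ubases M x).Infinite) := by
  have key : ∀ x : ℝ, 0 < x → x < xG M → (Ubases M x).Infinite := by
    intro x hx0 hx
    rcases lt_or_ge x 1 with h | h
    · exact infinite_Ubases_of_lt_one hM hx0 h
    · exact infinite_Ubases_of_one_le hM h hx
  refine ⟨key, fun x hx => ⟨countable_Ubases hM hx.1, key x ?_ hx.2⟩⟩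
  have hM' : (0 : ℝ) < M := by exact_mod_cast hM
  exact (div_pos hM' (by linarith [one_lt_qKL hM])).trans_le hx.1

end Expansions
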